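/- Let d ≥ 1, let s ∈ ℝ^d have i.i.d. standard Gaussian N(0,1) entries, let q, k ∈ ℝ^d with k ≠ 0, and define z := √(π/2) · ‖k‖₂ · ⟨s, q⟩ · sign(⟨s, k⟩). Then for every natural number ℓ ≥ 2, E[|z|^ℓ] ≤ E[|z|²] · ((2/3) · ‖k‖₂ · ‖q‖₂)^{ℓ−2} · ℓ!/2. -/

import Mathlib

open MeasureTheory ProbabilityTheory Real

/-- Product measure on `ℝ^d` with i.i.d. standard Gaussian `N(0,1)` coordinates. -/
noncomputable def stdGaussianVec (d : ℕ) : Measure (Fin d → ℝ) :=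
  Measure.pi fun _ => gaussianReal 0 1

/-- Euclidean inner product on `ℝ^d`. -/
def iprod {d : ℕ} (u v : Fin d → ℝ) : ℝ := ∑ i, u i * v i

/-- Euclidean norm on `ℝ^d`. -/
noncomputable def nrm {d : ℕ} (u : Fin d → ℝ) : ℝ := Real.sqrt (∑ i, (u i) ^ 2)

/-- Sign function: `1` if `x > 0` and `-1` if `x < 0` (the value at `0` is immaterial). -/
noncomputable def sgn (x : ℝ) : ℝ := if 0 < x then 1 else -1

/-- The law of `⟨s, q⟩` under the standard Gaussian measure is that of `‖q‖₂` times a standard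
Gaussian variable. -/
lemma map_iprod_stdGaussianVec {d : ℕ} (q : Fin d → ℝ) :
    (stdGaussianVec d).map (fun s => iprod s q)
      = (gaussianReal 0 1).map (fun x => nrm q * x) := by
  have hm : Measurable fun s : Fin d → ℝ => iprod s q := by
    unfold iprod
    fun_prop
  have : IsProbabilityMeasure (stdGaussianVec d) := by
    unfold stdGaussianVec
    infer_instance
  have : IsProbabilityMeasure ((stdGaussianVec d).map fun s => iprod s q) :=
    Measure.isProbabilityMeasure_map hm.aemeasurable
  have : IsProbabilityMeasure ((gaussianReal 0 1).map fun x => nrm q * x) :=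
    Measure.isProbabilityMeasure_map (by fun_prop)
  apply Measure.ext_of_charFun
  ext t
  have hlin : charFun ((stdGaussianVec d).map fun s => iprod s q) t
      = charFun ((stdGaussianVec d).map (WithLp.toLp 2)) (WithLp.toLp 2 (t • q)) := by
    rw [charFun_apply_real, charFun_apply, integral_map hm.aemeasurable (by fun_prop),
      integral_map (by fun_prop) (by fun_prop)]
    refine integral_congr_ae (.of_forall fun s => ?_)
    simp [iprod, PiLp.inner_apply, Finset.mul_sum, mul_comm, mul_left_comm]
  have hnorm : ‖(WithLp.toLp 2 (t • q) : EuclideanSpace ℝ (Fin d))‖ ^ 2 = (nrm q * t) ^ 2 := by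
    rw [EuclideanSpace.norm_sq_eq, mul_pow, nrm, Real.sq_sqrt (by positivity), Finset.sum_mul]
    simp [mul_pow, mul_comm]
  rw [hlin, stdGaussianVec, map_pi_eq_stdGaussian, charFun_stdGaussian, ← Complex.ofReal_pow,
    hnorm, charFun_map_mul, charFun_gaussianReal]
  simp [neg_div]

/-- The `n`-th absolute moment of a standard Gaussian variable. -/
lemma integral_abs_pow_gaussianReal (n : ℕ) :
    ∫ x, |x| ^ n ∂(gaussianReal 0 1)
      = (√(2 * π))⁻¹ * ((1 / 2 : ℝ) ^ (-((n : ℝ) + 1) / 2) * Gamma (((n : ℝ) + 1) / 2)) := by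
  have hn : (0 : ℝ) ≤ n := n.cast_nonneg
  have hGamma := integral_rpow_mul_exp_neg_mul_rpow (p := 2) (q := n) (b := 1 / 2)
    (by norm_num) (by linarith) (by norm_num)
  have habs := integral_comp_abs (f := fun x : ℝ => x ^ (n : ℝ) * rexp (-(1 / 2) * x ^ (2 : ℝ)))
  rw [hGamma] at habs
  rw [integral_gaussianReal_eq_integral_smul one_ne_zero]
  have hpdf (x : ℝ) : gaussianPDFReal 0 1 x • |x| ^ n
      = (√(2 * π))⁻¹ * (|x| ^ (n : ℝ) * rexp (-(1 / 2) * |x| ^ (2 : ℝ))) := by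
    simp only [gaussianPDFReal, smul_eq_mul, rpow_natCast, rpow_two, sq_abs, NNReal.coe_one,
      mul_one, sub_zero]
    rw [show -x ^ 2 / 2 = -(1 / 2) * x ^ 2 by ring]
    ring
  simp_rw [hpdf]
  rw [integral_const_mul, habs]
  ring

lemma integral_abs_pow_add_two_gaussianReal (n : ℕ) :
    ∫ x, |x| ^ (n + 2) ∂(gaussianReal 0 1)
      = ((n : ℝ) + 1) * ∫ x, |x| ^ n ∂(gaussianReal 0 1) := by
  have hn : (0 : ℝ) ≤ n := n.cast_nonneg
  rw [integral_abs_pow_gaussianReal, integral_abs_pow_gaussianReal]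
  push_cast
  rw [show ((n : ℝ) + 2 + 1) / 2 = ((n : ℝ) + 1) / 2 + 1 by ring,
    show -((n : ℝ) + 2 + 1) / 2 = -((n : ℝ) + 1) / 2 - 1 by ring,
    Gamma_add_one (by positivity), rpow_sub_one (by norm_num)]
  ring

lemma integral_abs_pow_two_gaussianReal : ∫ x, |x| ^ 2 ∂(gaussianReal 0 1) = 1 := by
  have h := integral_abs_pow_add_two_gaussianReal 0
  simpa using h

lemma integral_abs_pow_three_gaussianReal :
    √(π / 2) * ∫ x, |x| ^ 3 ∂(gaussianReal 0 1) = 2 := by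
  have h := integral_abs_pow_add_two_gaussianReal 1
  rw [integral_abs_pow_gaussianReal 1] at h
  rw [h, show (2 : ℝ) * π = 2 ^ 2 * (π / 2) by ring, sqrt_mul (by norm_num),
    sqrt_sq (by norm_num)]
  have hpos : √(π / 2) ≠ 0 := by positivity
  norm_num [rpow_neg_one]
  field_simp

/-- Bernstein-type bound on the absolute moments of a standard Gaussian variable, rescaled to
have unit mean absolute value. -/
lemma sqrt_pow_mul_integral_abs_pow_le (n : ℕ) :
    √(π / 2) ^ n * ∫ x, |x| ^ (n + 2) ∂(gaussianReal 0 1)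
      ≤ (2 / 3) ^ n * (n + 2).factorial / 2 := by
  induction n using Nat.twoStepInduction with
  | zero =>
    rw [integral_abs_pow_two_gaussianReal]
    norm_num [Nat.factorial]
  | one =>
    rw [pow_one, integral_abs_pow_three_gaussianReal]
    norm_num [Nat.factorial]
  | more n ih _ =>
    have hn : (0 : ℝ) ≤ n := n.cast_nonneg
    have hcoef : π / 2 * ((n : ℝ) + 3) ≤ (2 / 3) ^ 2 * (((n : ℝ) + 4) * (n + 3)) := by
      have : π / 2 ≤ (2 / 3) ^ 2 * ((n : ℝ) + 4) := by linarith [pi_lt_d2]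
      nlinarith
    rw [integral_abs_pow_add_two_gaussianReal, pow_add, sq_sqrt (by positivity)]
    calc √(π / 2) ^ n * (π / 2) * (((n + 2 : ℕ) + 1) * ∫ x, |x| ^ (n + 2) ∂(gaussianReal 0 1))
        = π / 2 * ((n : ℝ) + 3) * (√(π / 2) ^ n * ∫ x, |x| ^ (n + 2) ∂(gaussianReal 0 1)) := by
          push_cast; ring
      _ ≤ (2 / 3) ^ 2 * (((n : ℝ) + 4) * (n + 3)) * ((2 / 3) ^ n * (n + 2).factorial / 2) := by
          gcongr
      _ = (2 / 3) ^ (n + 2) * (n + 2 + 2).factorial / 2 := by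
          rw [Nat.factorial_succ (n + 2 + 1), Nat.factorial_succ (n + 2)]
          push_cast; ring

lemma abs_sgn (x : ℝ) : |sgn x| = 1 := by
  unfold sgn
  split_ifs <;> simp

/-- The absolute moments of the single-row term in terms of those of a standard Gaussian. -/
lemma integral_abs_mul_iprod_mul_sgn_pow {d : ℕ} (q k : Fin d → ℝ) (n : ℕ) :
    ∫ s, |√(π / 2) * nrm k * iprod s q * sgn (iprod s k)| ^ n ∂(stdGaussianVec d)
      = (√(π / 2) * nrm k * nrm q) ^ n * ∫ x, |x| ^ n ∂(gaussianReal 0 1) := by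
  have hm : Measurable fun s : Fin d → ℝ => iprod s q := by
    unfold iprod
    fun_prop
  have hk : 0 ≤ nrm k := sqrt_nonneg _
  have hq : 0 ≤ nrm q := sqrt_nonneg _
  have habs (s : Fin d → ℝ) : |√(π / 2) * nrm k * iprod s q * sgn (iprod s k)| ^ n
      = (√(π / 2) * nrm k) ^ n * |iprod s q| ^ n := by
    rw [abs_mul, abs_sgn, mul_one, abs_mul, abs_of_nonneg (by positivity), mul_pow]
  have hmap : ∫ s, |iprod s q| ^ n ∂(stdGaussianVec d)
      = ∫ x, |nrm q * x| ^ n ∂(gaussianReal 0 1) := by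
    rw [← integral_map (f := fun y : ℝ => |y| ^ n) hm.aemeasurable (by fun_prop),
      map_iprod_stdGaussianVec, integral_map (by fun_prop) (by fun_prop)]
  simp_rw [habs, integral_const_mul, hmap, abs_mul, abs_of_nonneg hq, mul_pow,
    integral_const_mul]
  ring

/-- Bernstein moment condition for the single-row QJL estimator term
`z = √(π/2) · ‖k‖₂ · ⟨s, q⟩ · sign(⟨s, k⟩)`:
`E[|z|^ℓ] ≤ E[|z|²] · ((2/3) · ‖k‖₂ · ‖q‖₂)^{ℓ−2} · ℓ!/2` for every `ℓ ≥ 2`. -/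
theorem qjl_bernstein_moment_condition (d : ℕ) (hd : 1 ≤ d) (q k : Fin d → ℝ)
    (hk : k ≠ 0) (ℓ : ℕ) (hℓ : 2 ≤ ℓ) :
    ∫ s, |Real.sqrt (Real.pi / 2) * nrm k * iprod s q * sgn (iprod s k)| ^ ℓ
        ∂(stdGaussianVec d)
      ≤ (∫ s, |Real.sqrt (Real.pi / 2) * nrm k * iprod s q * sgn (iprod s k)| ^ 2
            ∂(stdGaussianVec d))
          * ((2 / 3) * nrm k * nrm q) ^ (ℓ - 2) * (Nat.factorial ℓ) / 2 := by
  obtain ⟨n, rfl⟩ := Nat.exists_eq_add_of_le' hℓ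
  rw [integral_abs_mul_iprod_mul_sgn_pow, integral_abs_mul_iprod_mul_sgn_pow,
    integral_abs_pow_two_gaussianReal, Nat.add_sub_cancel]
  have hk_nonneg : 0 ≤ nrm k := sqrt_nonneg _
  have hq_nonneg : 0 ≤ nrm q := sqrt_nonneg _
  calc (√(π / 2) * nrm k * nrm q) ^ (n + 2) * ∫ x, |x| ^ (n + 2) ∂(gaussianReal 0 1)
      = (√(π / 2) * nrm k * nrm q) ^ 2 * (nrm k * nrm q) ^ n
          * (√(π / 2) ^ n * ∫ x, |x| ^ (n + 2) ∂(gaussianReal 0 1)) := by ring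
    _ ≤ (√(π / 2) * nrm k * nrm q) ^ 2 * (nrm k * nrm q) ^ n
          * ((2 / 3) ^ n * (n + 2).factorial / 2) := by
        gcongr
        exact sqrt_pow_mul_integral_abs_pow_le n
    _ = (√(π / 2) * nrm k * nrm q) ^ 2 * 1 * (2 / 3 * nrm k * nrm q) ^ n
          * (n + 2).factorial / 2 := by ring
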